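/- Coupling-time bound for ATO-TOS (Proposition 4.3): assume δ := min_{x∈X, x≠0} (Σ_{i=1}^I μ_i(x_i)) − Σ_{i=1}^I λ_i > 0. Then the backward coupling time τ^T = min{t ≥ 0 : |f_T(X, u_t u_{t−1}⋯u_1)| = 1} (the word applies u_t first) satisfies E[τ^T] ≤ (Λ/δ)·|C|, where |C| = Σ_{i=1}^I C_i. -/

import Mathlib

open MeasureTheory Finset ENNReal

namespace ATO

/-- Events: joint arrivals `d A` for subsets `A`, and services `s i j`. -/
inductive Ev (I : ℕ) where
  | d : Finset (Fin I) → Ev I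
  | s : Fin I → ℕ → Ev I

instance (I : ℕ) : MeasurableSpace (Ev I) := ⊤

/-- Valid events: arrivals for nonempty `A`, services `s i j` with `1 ≤ j ≤ C i`. -/
def ValidEv {I : ℕ} (C : Fin I → ℕ) : Ev I → Prop
  | .d A => A.Nonempty
  | .s i j => 1 ≤ j ∧ j ≤ C i

/-- The state space `X = {0,…,C 1} × ⋯ × {0,…,C I}`. -/
def Xspace {I : ℕ} (C : Fin I → ℕ) : Set (Fin I → ℕ) := {x | ∀ i, x i ≤ C i}

/-- ATO-POS transition function with individual replenishments. -/
noncomputable def fP {I : ℕ} (C : Fin I → ℕ) (μ : Fin I → ℕ → ℝ) (ℓ : Fin I → ℕ → ℕ)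
    (x : Fin I → ℕ) : Ev I → (Fin I → ℕ)
  | .d A => fun k => x k + if k ∈ A ∧ x k < C k then 1 else 0
  | .s i j => fun k => if k = i ∧ μ i (ℓ i j) ≤ μ i (x i) then x k - 1 else x k

/-- ATO-TOS transition function with individual replenishments. -/
noncomputable def fT {I : ℕ} (C : Fin I → ℕ) (μ : Fin I → ℕ → ℝ) (ℓ : Fin I → ℕ → ℕ)
    (x : Fin I → ℕ) : Ev I → (Fin I → ℕ)
  | .d A => fun k => x k + if k ∈ A ∧ (∀ i ∈ A, x i < C i) then 1 else 0
  | .s i j => fP C μ ℓ x (.s i j)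

/-- Iterated application of a transition function along a word (head applied first). -/
def iter {I : ℕ} {σ : Type*} (f : σ → Ev I → σ) : σ → List (Ev I) → σ
  | x, [] => x
  | x, a :: w => iter f (f x a) w

/-- The backward word `u_t u_{t-1} ⋯ u_1` (with `u_t` applied first). -/
def bword {I : ℕ} (ω : ℕ → Ev I) (t : ℕ) : List (Ev I) :=
  ((List.range t).reverse).map fun s => ω (s + 1)

/-- The forward word `u_1 u_2 ⋯ u_t` (with `u_1` applied first). -/
def fword {I : ℕ} (ω : ℕ → Ev I) (t : ℕ) : List (Ev I) :=
  (List.range t).map fun s => ω (s + 1)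

/-- The distribution `ν` on events: `ν (d A) = λ_A / Λ`, `ν (s i j) = (μ_i(ℓ_i^{(j)}) − μ_i(ℓ_i^{(j-1)}))/Λ`. -/
noncomputable def probA {I : ℕ} (C : Fin I → ℕ) (μ : Fin I → ℕ → ℝ) (ℓ : Fin I → ℕ → ℕ)
    (lam : Finset (Fin I) → ℝ) (Λ : ℝ) : Ev I → ℝ≥0∞
  | .d A => if A.Nonempty then ENNReal.ofReal (lam A / Λ) else 0
  | .s i j => if 1 ≤ j ∧ j ≤ C i then ENNReal.ofReal ((μ i (ℓ i j) - μ i (ℓ i (j - 1))) / Λ) else 0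

/-- Events as a sum type of arrivals and services. -/
def evEquiv (I : ℕ) : Ev I ≃ Finset (Fin I) ⊕ (Fin I × ℕ) where
  toFun
    | .d A => .inl A
    | .s i j => .inr (i, j)
  invFun
    | .inl A => .d A
    | .inr (i, j) => .s i j
  left_inv a := by cases a <;> rfl
  right_inv a := by rcases a with A | ⟨i, j⟩ <;> rfl

instance (I : ℕ) : Countable (Ev I) := (evEquiv I).countable_iff.mpr inferInstance

lemma bword_succ {I : ℕ} (ω : ℕ → Ev I) (t : ℕ) :
    bword ω (t + 1) = ω (t + 1) :: bword ω t := by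
  simp [bword, List.range_succ]

lemma measurableSet_bword {I : ℕ} (t : ℕ) (Q : List (Ev I) → Prop) :
    MeasurableSet {ω : ℕ → Ev I | Q (bword ω t)} := by
  induction t generalizing Q with
  | zero => simp [bword]
  | succ t ih =>
    have h : {ω : ℕ → Ev I | Q (bword ω (t + 1))} =
        ⋃ a, ((fun ω : ℕ → Ev I => ω (t + 1)) ⁻¹' {a}) ∩ {ω | Q (a :: bword ω t)} := by
      ext ω
      simp [bword_succ]
    rw [h]
    refine MeasurableSet.iUnion fun a => MeasurableSet.inter ?_ (ih fun w => Q (a :: w))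
    exact measurable_pi_apply _ MeasurableSpace.measurableSet_top

/-- The trajectory from `x` along a word never visits the empty state. -/
def Avoids {I : ℕ} (f : (Fin I → ℕ) → Ev I → (Fin I → ℕ)) : (Fin I → ℕ) → List (Ev I) → Prop
  | x, [] => x ≠ 0
  | x, a :: w => x ≠ 0 ∧ Avoids f (f x a) w

open Classical in
/-- The total weight of the words of length `t` along which the trajectory from `x` never visits
the empty state. -/
noncomputable def avoidWeight {I : ℕ} (p : Ev I → ℝ≥0∞) (f : (Fin I → ℕ) → Ev I → (Fin I → ℕ)) :
    ℕ → (Fin I → ℕ) → ℝ≥0∞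
  | 0, x => if x = 0 then 0 else 1
  | t + 1, x => if x = 0 then 0 else ∑' a, p a * avoidWeight p f t (f x a)

lemma avoidWeight_zero_state {I : ℕ} (p : Ev I → ℝ≥0∞)
    (f : (Fin I → ℕ) → Ev I → (Fin I → ℕ)) (t : ℕ) : avoidWeight p f t 0 = 0 := by
  cases t <;> simp [avoidWeight]

lemma not_avoids_zero {I : ℕ} (f : (Fin I → ℕ) → Ev I → (Fin I → ℕ)) (w : List (Ev I)) :
    ¬ Avoids f 0 w := by
  cases w <;> simp [Avoids]

lemma measure_cylinder_inter_avoids_le {I : ℕ} (p : Ev I → ℝ≥0∞)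
    (f : (Fin I → ℕ) → Ev I → (Fin I → ℕ)) (P : Measure (ℕ → Ev I))
    (hiid : ∀ (T : Finset ℕ) (u : ℕ → Ev I), P {ω | ∀ t ∈ T, ω t = u t} = ∏ t ∈ T, p (u t))
    (t : ℕ) (x : Fin I → ℕ) (T : Finset ℕ) (hT : ∀ s ∈ T, t < s) (u : ℕ → Ev I) :
    P ({ω | ∀ s ∈ T, ω s = u s} ∩ {ω | Avoids f x (bword ω t)})
      ≤ (∏ s ∈ T, p (u s)) * avoidWeight p f t x := by
  induction t generalizing x T u with
  | zero =>
    by_cases hx : x = 0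
    · subst hx; simp [not_avoids_zero]
    · simp only [avoidWeight, hx, if_false, mul_one]
      exact (measure_mono Set.inter_subset_left).trans (hiid T u).le
  | succ t ih =>
    by_cases hx : x = 0
    · subst hx; simp [not_avoids_zero]
    have hnot : t + 1 ∉ T := fun h => lt_irrefl _ (hT _ h)
    have hne : ∀ s ∈ T, s ≠ t + 1 := fun s hs h => hnot (h ▸ hs)
    have hsub : {ω : ℕ → Ev I | ∀ s ∈ T, ω s = u s} ∩ {ω | Avoids f x (bword ω (t + 1))} ⊆
        ⋃ a, ({ω | ∀ s ∈ insert (t + 1) T, ω s = Function.update u (t + 1) a s} ∩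
          {ω | Avoids f (f x a) (bword ω t)}) := by
      rintro ω ⟨h1, h2⟩
      simp only [Set.mem_ofPred_eq, bword_succ, Avoids] at h1 h2
      refine Set.mem_iUnion.mpr ⟨ω (t + 1), ?_, h2.2⟩
      intro s hs
      rcases Finset.mem_insert.mp hs with rfl | hs
      · simp
      · rw [Function.update_of_ne (hne s hs), h1 s hs]
    refine (measure_mono hsub).trans ((measure_iUnion_le _).trans ?_)
    simp only [avoidWeight, hx, if_false]
    rw [← ENNReal.tsum_mul_left]
    refine ENNReal.tsum_le_tsum fun a => ?_
    refine (ih (f x a) (insert (t + 1) T) ?_ _).trans_eq ?_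
    · intro s hs
      rcases Finset.mem_insert.mp hs with rfl | hs
      · exact Nat.lt_succ_self t
      · exact (Nat.lt_succ_self t).trans (hT s hs)
    · rw [Finset.prod_insert hnot, Function.update_self,
        Finset.prod_congr rfl fun s hs => by rw [Function.update_of_ne (hne s hs)]]
      ring

/-- Foster–Lyapunov bound: if `p` decreases `V` by at least one on average away from the empty
state, then the expected hitting time of the empty state is at most `V`. -/
lemma sum_avoidWeight_le {I : ℕ} (p : Ev I → ℝ≥0∞) (f : (Fin I → ℕ) → Ev I → (Fin I → ℕ))
    (X : Set (Fin I → ℕ)) (hX : ∀ x ∈ X, ∀ a, f x a ∈ X) (V : (Fin I → ℕ) → ℝ≥0∞)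
    (hV : ∀ x ∈ X, x ≠ 0 → 1 + ∑' a, p a * V (f x a) ≤ V x)
    (n : ℕ) (x : Fin I → ℕ) (hx : x ∈ X) :
    ∑ t ∈ Finset.range n, avoidWeight p f t x ≤ V x := by
  induction n generalizing x with
  | zero => simp
  | succ n ih =>
    by_cases h0 : x = 0
    · subst h0; simp [avoidWeight_zero_state]
    refine le_trans ?_ (hV x hx h0)
    rw [Finset.sum_range_succ']
    simp only [avoidWeight, h0, if_false]
    rw [← Summable.tsum_finsetSum (fun _ _ => ENNReal.summable), add_comm]
    gcongr with a
    rw [← Finset.mul_sum]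
    gcongr
    exact ih _ (hX x hx a)

lemma fP_mem_Xspace {I : ℕ} (C : Fin I → ℕ) (μ : Fin I → ℕ → ℝ) (ℓ : Fin I → ℕ → ℕ)
    (x : Fin I → ℕ) (hx : x ∈ Xspace C) (a : Ev I) : fP C μ ℓ x a ∈ Xspace C := by
  intro k
  have : x k ≤ C k := hx k
  cases a <;> simp only [fP] <;> split_ifs <;> omega

lemma fT_le_fP {I : ℕ} (C : Fin I → ℕ) (μ : Fin I → ℕ → ℝ) (ℓ : Fin I → ℕ → ℕ)
    (x y : Fin I → ℕ) (hxy : x ≤ y) (a : Ev I) : fT C μ ℓ x a ≤ fP C μ ℓ y a := by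
  intro k
  have hk : x k ≤ y k := hxy k
  rcases hk.eq_or_lt with h | h
  · cases a with
    | d A =>
      simp only [fT, fP]
      by_cases hA : k ∈ A ∧ ∀ i ∈ A, x i < C i
      · rw [if_pos hA, if_pos ⟨hA.1, h ▸ hA.2 k hA.1⟩, h]
      · rw [if_neg hA]; omega
    | s i j =>
      simp only [fT, fP]
      by_cases hki : k = i
      · subst hki; rw [h]
      · simp [hki, h]
  · cases a <;> simp only [fT, fP] <;> split_ifs <;> omega

lemma iter_fT_eq_of_not_avoids {I : ℕ} (C : Fin I → ℕ) (μ : Fin I → ℕ → ℝ) (ℓ : Fin I → ℕ → ℕ)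
    (w : List (Ev I)) (x x' y : Fin I → ℕ) (hx : x ≤ y) (hx' : x' ≤ y)
    (h : ¬ Avoids (fP C μ ℓ) y w) : iter (fT C μ ℓ) x w = iter (fT C μ ℓ) x' w := by
  induction w generalizing x x' y with
  | nil =>
    have hy : y = 0 := by simpa [Avoids] using h
    subst hy
    rw [nonpos_iff_eq_zero.mp hx, nonpos_iff_eq_zero.mp hx']
  | cons a w ih =>
    by_cases hy : y = 0
    · subst hy
      rw [nonpos_iff_eq_zero.mp hx, nonpos_iff_eq_zero.mp hx']
    · exact ih _ _ _ (fT_le_fP C μ ℓ x y hx a) (fT_le_fP C μ ℓ x' y hx' a)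
        fun hw => h ⟨hy, hw⟩

open Classical in
lemma sInf_natCast_le_tsum (K : ℕ → Prop) :
    sInf {r : ℝ≥0∞ | ∃ t : ℕ, r = t ∧ K t} ≤ ∑' t, if K t then 0 else 1 := by
  by_cases h : ∃ t, K t
  · refine le_trans (sInf_le ⟨Nat.find h, rfl, Nat.find_spec h⟩) ?_
    refine le_trans ?_ (ENNReal.sum_le_tsum (Finset.range (Nat.find h)))
    rw [Finset.sum_congr rfl fun t ht => if_neg (Nat.find_min h (Finset.mem_range.mp ht))]
    simp
  · push Not at h
    simp [h]

lemma tsum_ev {I : ℕ} (g : Ev I → ℝ≥0∞) :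
    ∑' a, g a = ∑ A, g (.d A) + ∑ i, ∑' j, g (.s i j) := by
  rw [← (evEquiv I).symm.tsum_eq, Summable.tsum_sum ENNReal.summable ENNReal.summable,
    ENNReal.tsum_prod', tsum_fintype, tsum_fintype]
  rfl

/-- Averages under `probA` of a nonnegative function as finite real sums. -/
lemma tsum_probA_mul_ofReal {I : ℕ} (C : Fin I → ℕ) (μ : Fin I → ℕ → ℝ) (ℓ : Fin I → ℕ → ℕ)
    (lam : Finset (Fin I) → ℝ) (Λ : ℝ) (hΛ : 0 < Λ) (hlam : ∀ A, 0 ≤ lam A) (hlam0 : lam ∅ = 0)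
    (hsort : ∀ i j, j < C i → μ i (ℓ i j) ≤ μ i (ℓ i (j + 1)))
    (g : Ev I → ℝ) (hg : ∀ a, 0 ≤ g a) :
    ∑' a, probA C μ ℓ lam Λ a * ENNReal.ofReal (g a) =
      ENNReal.ofReal (∑ A, lam A / Λ * g (.d A) +
        ∑ i, ∑ j ∈ Finset.range (C i),
          (μ i (ℓ i (j + 1)) - μ i (ℓ i j)) / Λ * g (.s i (j + 1))) := by
  have hs : ∀ i, ∀ j ∈ Finset.range (C i),
      0 ≤ (μ i (ℓ i (j + 1)) - μ i (ℓ i j)) / Λ :=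
    fun i j hj => div_nonneg (sub_nonneg.mpr (hsort i j (Finset.mem_range.mp hj))) hΛ.le
  have hs' : ∀ i, ∀ j ∈ Finset.range (C i),
      0 ≤ (μ i (ℓ i (j + 1)) - μ i (ℓ i j)) / Λ * g (.s i (j + 1)) :=
    fun i j hj => mul_nonneg (hs i j hj) (hg _)
  have hd : ∀ A, 0 ≤ lam A / Λ := fun A => div_nonneg (hlam A) hΛ.le
  rw [tsum_ev, ENNReal.ofReal_add
      (Finset.sum_nonneg fun A _ => mul_nonneg (hd A) (hg _))
      (Finset.sum_nonneg fun i _ => Finset.sum_nonneg (hs' i)),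
    ENNReal.ofReal_sum_of_nonneg fun A _ => mul_nonneg (hd A) (hg _),
    ENNReal.ofReal_sum_of_nonneg fun i _ => Finset.sum_nonneg (hs' i)]
  congr 1
  · refine Finset.sum_congr rfl fun A _ => ?_
    rw [ENNReal.ofReal_mul (hd A)]
    rcases A.eq_empty_or_nonempty with rfl | hA
    · simp [probA, hlam0]
    · simp [probA, hA]
  · refine Finset.sum_congr rfl fun i _ => ?_
    rw [ENNReal.ofReal_sum_of_nonneg (hs' i), tsum_eq_zero_add' ENNReal.summable,
      tsum_eq_sum (s := Finset.range (C i))]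
    · simp only [probA]
      rw [if_neg (by omega), zero_mul, zero_add]
      refine Finset.sum_congr rfl fun j hj => ?_
      rw [ENNReal.ofReal_mul (hs i j hj), if_pos (by have := Finset.mem_range.mp hj; omega)]
      simp
    · intro j hj
      have := Finset.mem_range.not.mp hj
      simp only [probA]
      rw [if_neg (by omega), zero_mul]

lemma sum_fP_d_le {I : ℕ} (C : Fin I → ℕ) (μ : Fin I → ℕ → ℝ) (ℓ : Fin I → ℕ → ℕ)
    (x : Fin I → ℕ) (A : Finset (Fin I)) :
    ∑ k, (fP C μ ℓ x (.d A) k : ℝ) ≤ ∑ k, (x k : ℝ) + ∑ k, if k ∈ A then 1 else 0 := by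
  rw [← Finset.sum_add_distrib]
  refine Finset.sum_le_sum fun k _ => ?_
  simp only [fP]
  by_cases hk : k ∈ A
  · by_cases h : x k < C k <;> simp [hk, h]
  · simp [hk]

lemma sum_fP_s {I : ℕ} (C : Fin I → ℕ) (μ : Fin I → ℕ → ℝ) (ℓ : Fin I → ℕ → ℕ)
    (x : Fin I → ℕ) (i : Fin I) (j : ℕ) (h0 : x i = 0 → μ i (x i) < μ i (ℓ i j)) :
    ∑ k, (fP C μ ℓ x (.s i j) k : ℝ) =
      ∑ k, (x k : ℝ) - if μ i (ℓ i j) ≤ μ i (x i) then 1 else 0 := by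
  have : ∀ k, (fP C μ ℓ x (.s i j) k : ℝ) =
      x k - if k = i then (if μ i (ℓ i j) ≤ μ i (x i) then 1 else 0) else 0 := by
    intro k
    simp only [fP]
    by_cases hk : k = i
    · subst hk
      by_cases h : μ k (ℓ k j) ≤ μ k (x k)
      · have : 1 ≤ x k := Nat.one_le_iff_ne_zero.mpr fun hx => absurd h (not_le.mpr (h0 hx))
        simp [h, Nat.cast_sub this]
      · simp [h]
    · simp [hk]
  simp [this, Finset.sum_sub_distrib]

/-- The total rate of the services active at level `m` is at least `μ m`. -/
lemma le_sum_service (c : ℕ) (μ : ℕ → ℝ) (hμ0 : μ 0 = 0)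
    (ℓ : ℕ → ℕ) (hℓ : Set.BijOn ℓ (Set.Iic c) (Set.Iic c))
    (hsort : ∀ j, j < c → μ (ℓ j) ≤ μ (ℓ (j + 1))) (m : ℕ) (hm : m ≤ c) :
    μ m ≤ ∑ j ∈ Finset.range c, (μ (ℓ (j + 1)) - μ (ℓ j)) *
      if μ (ℓ (j + 1)) ≤ μ m then 1 else 0 := by
  have hmono : ∀ a b, a ≤ b → b ≤ c → μ (ℓ a) ≤ μ (ℓ b) := by
    intro a b hab
    induction b, hab using Nat.le_induction with
    | base => intro; rfl
    | succ b _ ih => intro hb; exact (ih (by omega)).trans (hsort b (by omega))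
  obtain ⟨z, hz, hz0⟩ := hℓ.surjOn (Set.mem_Iic.mpr (Nat.zero_le c))
  obtain ⟨k, hk, rfl⟩ := hℓ.surjOn (Set.mem_Iic.mpr hm)
  have hzero : μ (ℓ 0) ≤ 0 := by
    have := hmono 0 z (Nat.zero_le _) hz
    rwa [hz0, hμ0] at this
  calc μ (ℓ k) ≤ ∑ j ∈ Finset.range k, (μ (ℓ (j + 1)) - μ (ℓ j)) := by
        rw [Finset.sum_range_sub (fun j => μ (ℓ j))]; linarith
    _ = ∑ j ∈ Finset.range k, (μ (ℓ (j + 1)) - μ (ℓ j)) *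
          if μ (ℓ (j + 1)) ≤ μ (ℓ k) then 1 else 0 := by
        refine Finset.sum_congr rfl fun j hj => ?_
        rw [if_pos (hmono _ _ (Finset.mem_range.mp hj) hk), mul_one]
    _ ≤ _ := by
        refine Finset.sum_le_sum_of_subset_of_nonneg (Finset.range_mono hk) fun j hj _ => ?_
        have := hsort j (Finset.mem_range.mp hj)
        split_ifs <;> linarith

/-- The total number of items in the POS system has drift at most `-δ / Λ` away from `0`. -/
lemma drift_le {I : ℕ} (C : Fin I → ℕ) (μ : Fin I → ℕ → ℝ) (hμ0 : ∀ i, μ i 0 = 0)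
    (hμnn : ∀ i k, k ≤ C i → 0 ≤ μ i k)
    (ℓ : Fin I → ℕ → ℕ) (hℓ : ∀ i, Set.BijOn (ℓ i) (Set.Iic (C i)) (Set.Iic (C i)))
    (hsort : ∀ i j, j < C i → μ i (ℓ i j) ≤ μ i (ℓ i (j + 1)))
    (lam : Finset (Fin I) → ℝ) (hlam : ∀ A, 0 ≤ lam A)
    (β : Fin I → ℝ) (hβ : ∀ i, IsGreatest (μ i '' Set.Iic (C i)) (β i))
    (Λ : ℝ) (hΛ : Λ = (∑ A, lam A) + ∑ i, β i) (hΛpos : 0 < Λ)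
    (x : Fin I → ℕ) (hx : x ∈ Xspace C) :
    ∑ A, lam A / Λ * ∑ k, (fP C μ ℓ x (.d A) k : ℝ) +
        ∑ i, ∑ j ∈ Finset.range (C i), (μ i (ℓ i (j + 1)) - μ i (ℓ i j)) / Λ *
          ∑ k, (fP C μ ℓ x (.s i (j + 1)) k : ℝ) ≤
      ∑ k, (x k : ℝ) +
        (∑ k, ∑ A ∈ Finset.univ.filter (fun A => k ∈ A), lam A - ∑ k, μ k (x k)) / Λ := by
  set S : ℝ := ∑ k, (x k : ℝ) with hS
  have hS0 : 0 ≤ S := Finset.sum_nonneg fun _ _ => Nat.cast_nonneg _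
  have hℓC : ∀ i j, j ≤ C i → ℓ i j ≤ C i := fun i j hj => (hℓ i).mapsTo hj
  have harr : ∑ A, lam A * ∑ k, (fP C μ ℓ x (.d A) k : ℝ) ≤
      (∑ A, lam A) * S + ∑ k, ∑ A ∈ Finset.univ.filter (fun A => k ∈ A), lam A := by
    calc _ ≤ ∑ A, lam A * (S + ∑ k, if k ∈ A then 1 else 0) :=
          Finset.sum_le_sum fun A _ => mul_le_mul_of_nonneg_left (sum_fP_d_le C μ ℓ x A) (hlam A)
      _ = _ := by
          simp only [mul_add, Finset.sum_add_distrib, Finset.sum_mul, Finset.mul_sum,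
            Finset.sum_filter, mul_ite, mul_one, mul_zero]
          rw [Finset.sum_comm (s := (Finset.univ : Finset (Fin I)))]
  have hserv : ∀ i, ∑ j ∈ Finset.range (C i), (μ i (ℓ i (j + 1)) - μ i (ℓ i j)) *
      ∑ k, (fP C μ ℓ x (.s i (j + 1)) k : ℝ) ≤ β i * S - μ i (x i) := by
    intro i
    have h1 := le_sum_service (C i) (μ i) (hμ0 i) (ℓ i) (hℓ i) (hsort i) (x i) (hx i)
    have h2 : ∑ j ∈ Finset.range (C i), (μ i (ℓ i (j + 1)) - μ i (ℓ i j)) ≤ β i := by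
      rw [Finset.sum_range_sub (fun j => μ i (ℓ i j))]
      have := (hβ i).2 ⟨ℓ i (C i), hℓC i _ le_rfl, rfl⟩
      linarith [hμnn i _ (hℓC i 0 (Nat.zero_le _))]
    have h3 : ∀ j ∈ Finset.range (C i), (μ i (ℓ i (j + 1)) - μ i (ℓ i j)) *
        ∑ k, (fP C μ ℓ x (.s i (j + 1)) k : ℝ) =
        (μ i (ℓ i (j + 1)) - μ i (ℓ i j)) * S - (μ i (ℓ i (j + 1)) - μ i (ℓ i j)) *
          if μ i (ℓ i (j + 1)) ≤ μ i (x i) then 1 else 0 := by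
      intro j hj
      have hj' := Finset.mem_range.mp hj
      by_cases h0 : x i = 0 → μ i (x i) < μ i (ℓ i (j + 1))
      · rw [sum_fP_s C μ ℓ x i (j + 1) h0, mul_sub]
      · push Not at h0
        have h4 : μ i (ℓ i (j + 1)) - μ i (ℓ i j) = 0 := by
          have := h0.2
          rw [h0.1, hμ0 i] at this
          linarith [hsort i j hj', hμnn i _ (hℓC i j hj'.le)]
        rw [h4]; ring
    rw [Finset.sum_congr rfl h3, Finset.sum_sub_distrib, ← Finset.sum_mul]
    linarith [mul_le_mul_of_nonneg_right h2 hS0]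
  have hserv' := Finset.sum_le_sum fun i (_ : i ∈ Finset.univ) => hserv i
  rw [Finset.sum_sub_distrib, ← Finset.sum_mul] at hserv'
  simp only [div_mul_eq_mul_div, ← Finset.sum_div]
  rw [← add_div, ← sub_nonneg, show ∀ a b c : ℝ, a + b / Λ - c / Λ = (Λ * a + b - c) / Λ by
    intro a b c; field_simp]
  refine div_nonneg ?_ hΛpos.le
  rw [hΛ]
  linarith [add_mul (∑ A, lam A) (∑ i, β i) S]

/-- Proposition 4.3: coupling-time bound for ATO-TOS. -/
theorem stmt8 (I : ℕ) (hI : 1 ≤ I) (C : Fin I → ℕ) (hC : ∀ i, 1 ≤ C i)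
    (μ : Fin I → ℕ → ℝ) (hμ0 : ∀ i, μ i 0 = 0) (hμnn : ∀ i k, k ≤ C i → 0 ≤ μ i k)
    (ℓ : Fin I → ℕ → ℕ) (hℓ : ∀ i, Set.BijOn (ℓ i) (Set.Iic (C i)) (Set.Iic (C i)))
    (hsort : ∀ i j, j < C i → μ i (ℓ i j) ≤ μ i (ℓ i (j + 1)))
    (lam : Finset (Fin I) → ℝ) (hlamnn : ∀ A, 0 ≤ lam A) (hlam0 : lam ∅ = 0)
    (β : Fin I → ℝ) (hβ : ∀ i, IsGreatest (μ i '' Set.Iic (C i)) (β i))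
    (Λ : ℝ) (hΛ : Λ = (∑ A : Finset (Fin I), lam A) + ∑ i, β i) (hΛpos : 0 < Λ)
    (lamI : Fin I → ℝ)
    (hlamI : ∀ i, lamI i = ∑ A ∈ Finset.univ.filter (fun A => i ∈ A), lam A)
    (P : Measure (ℕ → Ev I)) [IsProbabilityMeasure P]
    (hiid : ∀ (T : Finset ℕ) (u : ℕ → Ev I),
        P {ω | ∀ t ∈ T, ω t = u t} = ∏ t ∈ T, probA C μ ℓ lam Λ (u t))
    (mv δ : ℝ)
    (hmv : IsLeast {v : ℝ | ∃ x ∈ Xspace C, x ≠ 0 ∧ v = ∑ i, μ i (x i)} mv)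
    (hδ : δ = mv - ∑ i, lamI i) (hδpos : 0 < δ) :
    ∫⁻ ω, sInf {r : ℝ≥0∞ | ∃ t : ℕ, r = t ∧
        ∃ c : Fin I → ℕ, (fun x => iter (fT C μ ℓ) x (bword ω t)) '' Xspace C = {c}} ∂P
      ≤ ENNReal.ofReal (Λ / δ * ∑ i, (C i : ℝ)) := by
  classical
  set p := probA C μ ℓ lam Λ with hp
  have hΛδ : 0 < Λ / δ := div_pos hΛpos hδpos
  have hV : ∀ x ∈ Xspace C, x ≠ 0 →
      1 + ∑' a, p a * ENNReal.ofReal (Λ / δ * ∑ k, (fP C μ ℓ x a k : ℝ)) ≤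
        ENNReal.ofReal (Λ / δ * ∑ k, (x k : ℝ)) := by
    intro x hx hx0
    have hdrift := drift_le C μ hμ0 hμnn ℓ hℓ hsort lam hlamnn β hβ Λ hΛ hΛpos x hx
    have hle : mv ≤ ∑ i, μ i (x i) := hmv.2 ⟨x, hx, hx0, rfl⟩
    rw [hp, tsum_probA_mul_ofReal C μ ℓ lam Λ hΛpos hlamnn hlam0 hsort
        (fun a => Λ / δ * ∑ k, (fP C μ ℓ x a k : ℝ)) (fun a => by positivity),
      ← ENNReal.ofReal_one, ← ENNReal.ofReal_add zero_le_one]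
    · refine ENNReal.ofReal_le_ofReal ?_
      simp only [mul_left_comm _ (Λ / δ), ← Finset.mul_sum, ← mul_add] at hdrift ⊢
      have hrate : (∑ k, ∑ A ∈ Finset.univ.filter (fun A => k ∈ A), lam A
          - ∑ k, μ k (x k)) / Λ ≤ -(δ / Λ) := by
        rw [← neg_div]
        refine div_le_div_of_nonneg_right ?_ hΛpos.le
        simp only [← hlamI]
        linarith
      have hone : Λ / δ * (δ / Λ) = 1 := by field_simp
      have := mul_le_mul_of_nonneg_left (hdrift.trans (add_le_add_right hrate _)) hΛδ.le
      linarith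
    · have : ∀ i, ∀ j ∈ Finset.range (C i), 0 ≤ μ i (ℓ i (j + 1)) - μ i (ℓ i j) :=
        fun i j hj => sub_nonneg.mpr (hsort i j (Finset.mem_range.mp hj))
      refine add_nonneg (Finset.sum_nonneg fun A _ => ?_)
        (Finset.sum_nonneg fun i _ => Finset.sum_nonneg fun j hj => ?_)
      · have := hlamnn A
        positivity
      · have := this i j hj
        positivity
  have hcouple : ∀ w : List (Ev I), ¬ Avoids (fP C μ ℓ) C w →
      ∃ c : Fin I → ℕ, (fun x => iter (fT C μ ℓ) x w) '' Xspace C = {c} := by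
    intro w hw
    refine ⟨iter (fT C μ ℓ) C w, Set.eq_singleton_iff_unique_mem.mpr
      ⟨⟨C, fun i => le_rfl, rfl⟩, ?_⟩⟩
    rintro _ ⟨x, hx, rfl⟩
    exact iter_fT_eq_of_not_avoids C μ ℓ w x C C hx le_rfl hw
  calc _ ≤ ∫⁻ ω, ∑' t, Set.indicator {ω | Avoids (fP C μ ℓ) C (bword ω t)} 1 ω ∂P := by
        refine lintegral_mono fun ω => (sInf_natCast_le_tsum _).trans
          (ENNReal.tsum_le_tsum fun t => ?_)
        by_cases h : Avoids (fP C μ ℓ) C (bword ω t)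
        · rw [Set.indicator_of_mem (Set.mem_ofPred_eq ▸ h)]
          split_ifs <;> simp
        · rw [if_pos (hcouple _ h)]
          exact zero_le
    _ = ∑' t, P {ω | Avoids (fP C μ ℓ) C (bword ω t)} := by
        rw [lintegral_tsum fun t =>
          (measurable_one.indicator (measurableSet_bword t _)).aemeasurable]
        exact tsum_congr fun t => lintegral_indicator_one (measurableSet_bword t _)
    _ ≤ ∑' t, avoidWeight p (fP C μ ℓ) t C := by
        refine ENNReal.tsum_le_tsum fun t => ?_
        obtain ⟨i⟩ : Nonempty (Fin I) := ⟨⟨0, hI⟩⟩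
        simpa using measure_cylinder_inter_avoids_le p (fP C μ ℓ) P hiid t C ∅
          (by simp) (fun _ => .s i 0)
    _ ≤ _ := ENNReal.tsum_le_of_sum_range_le fun n =>
        sum_avoidWeight_le p (fP C μ ℓ) (Xspace C) (fP_mem_Xspace C μ ℓ)
          (fun x => ENNReal.ofReal (Λ / δ * ∑ k, (x k : ℝ))) hV n C fun i => le_rfl

end ATO
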